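/- (Proposition 1, joint distribution of welfare before and after a price change.) Fix a family of nested opportunity sets (Λ, p̃) for income y and price vectors p, p' : C → ℝ. For i, j ∈ C let W⁰_i ω denote the NOS welfare measure of type ω at alternative i with price p i, and W¹_j ω the NOS welfare measure of type ω at alternative j with price p' j. Then for all w, z ∈ Λ: μ {ω | w ≤ W⁰_i ω and z ≤ W¹_j ω and i is weakly optimal for ω at (p, y) and j is weakly optimal for ω at (p', y)} equals P_{i,j}(min(p, p̃ w), min(p', p̃ z), y) if both p i ≤ p̃ i w and p' j ≤ p̃ j z, and equals 0 otherwise, where min denotes the componentwise minimum of price vectors. -/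

import Mathlib

open MeasureTheory
open scoped ENNReal BigOperators

/-- `i` is weakly optimal for type `ω` at price vector `p` and income `y`:
its utility is weakly largest among all alternatives. -/
def WeakOpt {Ω : Type*} {n : ℕ} (U : Ω → Fin n → ℝ → ℝ) (ω : Ω)
    (p : Fin n → ℝ) (y : ℝ) (i : Fin n) : Prop :=
  ∀ c, U ω c (y - p c) ≤ U ω i (y - p i)

/-- Choice probability `P_i(p, y)`. -/
noncomputable def ChoiceProb {Ω : Type*} [MeasurableSpace Ω] {n : ℕ}
    (μ : Measure Ω) (U : Ω → Fin n → ℝ → ℝ) (p : Fin n → ℝ) (y : ℝ) (i : Fin n) : ℝ≥0∞ :=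
  μ {ω | WeakOpt U ω p y i}

/-- Transition probability `P_{i,j}(p, p', y)`. -/
noncomputable def TransProb {Ω : Type*} [MeasurableSpace Ω] {n : ℕ}
    (μ : Measure Ω) (U : Ω → Fin n → ℝ → ℝ) (p p' : Fin n → ℝ) (y : ℝ) (i j : Fin n) : ℝ≥0∞ :=
  μ {ω | WeakOpt U ω p y i ∧ WeakOpt U ω p' y j}

/-- Regularity condition (R1): for every type, every pair of alternatives and every
residual numeraire level, sufficiently poor levels at `c'` are worse and sufficiently
rich levels at `c'` are better. -/
def Reg1 {Ω : Type*} {n : ℕ} (U : Ω → Fin n → ℝ → ℝ) : Prop :=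
  ∀ (ω : Ω) (c c' : Fin n) (m : ℝ),
    (∃ m₀ : ℝ, ∀ m' ≤ m₀, U ω c' m' < U ω c m) ∧
    (∃ m₁ : ℝ, ∀ m', m₁ ≤ m' → U ω c m < U ω c' m')

/-- Negligible ties (R2): at any price vector and income, the set of types indifferent
between two distinct alternatives has measure zero. -/
def Reg2 {Ω : Type*} [MeasurableSpace Ω] {n : ℕ} (μ : Measure Ω)
    (U : Ω → Fin n → ℝ → ℝ) : Prop :=
  ∀ (q : Fin n → ℝ) (y : ℝ) (c c' : Fin n), c ≠ c' →
    μ {ω | U ω c (y - q c) = U ω c' (y - q c')} = 0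

/-- A family of nested opportunity sets, described by an index set `Λ ⊆ ℝ`
and virtual prices `ptilde`. -/
structure NOSFamily {n : ℕ} (Λ : Set ℝ) (ptilde : ℝ → Fin n → ℝ) : Prop where
  nonempty : Λ.Nonempty
  closed : IsClosed Λ
  cont : ∀ c : Fin n, ContinuousOn (fun l => ptilde l c) Λ
  anti : ∀ l ∈ Λ, ∀ l' ∈ Λ, l < l' →
    (∀ c, ptilde l' c ≤ ptilde l c) ∧ ∃ c, ptilde l' c < ptilde l c
  unbddAbove : ∀ (c : Fin n) (M : ℝ), ∃ l ∈ Λ, M ≤ ptilde l c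
  unbddBelow : ∃ c : Fin n, ∀ M : ℝ, ∃ l ∈ Λ, ptilde l c ≤ M

/-- The NOS welfare measure of type `ω` at alternative `k` with price `pk`. -/
noncomputable def NOSWelfare {Ω : Type*} {n : ℕ} (U : Ω → Fin n → ℝ → ℝ)
    (Λ : Set ℝ) (ptilde : ℝ → Fin n → ℝ) (y : ℝ) (k : Fin n) (pk : ℝ) (ω : Ω) : ℝ :=
  sSup {l | l ∈ Λ ∧ ∀ c, U ω c (y - ptilde l c) ≤ U ω k (y - pk)}

/-- The money-metric utility of type `ω` at alternative `k` with price `pk`,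
income `y` and reference prices `r`. -/
noncomputable def MMU {Ω : Type*} {n : ℕ} (U : Ω → Fin n → ℝ → ℝ)
    (r : Fin n → ℝ) (y : ℝ) (k : Fin n) (pk : ℝ) (ω : Ω) : ℝ :=
  sSup {l : ℝ | ∀ c, U ω c (l - r c) ≤ U ω k (y - pk)}

/-- `CV` is a compensating variation for the price change from `p` to `p'` at income `y`. -/
def IsCV {Ω : Type*} {n : ℕ} (U : Ω → Fin n → ℝ → ℝ)
    (p p' : Fin n → ℝ) (y : ℝ) (CV : Ω → ℝ) : Prop :=
  ∀ ω, (⨆ c, U ω c (y - p c)) = ⨆ c, U ω c (y - p' c - CV ω)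

/-- `EV` is an equivalent variation for the price change from `p` to `p'` at income `y`. -/
def IsEV {Ω : Type*} {n : ℕ} (U : Ω → Fin n → ℝ → ℝ)
    (p p' : Fin n → ℝ) (y : ℝ) (EV : Ω → ℝ) : Prop :=
  ∀ ω, (⨆ c, U ω c (y - p c - EV ω)) = ⨆ c, U ω c (y - p' c)

theorem NOSFamily.antitoneOn {n : ℕ} {Λ : Set ℝ} {ptilde : ℝ → Fin n → ℝ}
    (hFam : NOSFamily Λ ptilde) (c : Fin n) : AntitoneOn (fun l => ptilde l c) Λ := by
  intro l hl l' hl' h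
  rcases h.eq_or_lt with rfl | h
  · exact le_rfl
  · exact (hFam.anti l hl l' hl' h).1 c

/-- A welfare level in `Λ` is attained by the NOS welfare measure exactly when the corresponding
virtual opportunity set is no better than the realized alternative. -/
theorem le_nosWelfare_iff {Ω : Type*} {n : ℕ} {U : Ω → Fin n → ℝ → ℝ}
    (hCont : ∀ ω c, Continuous (U ω c)) (hMono : ∀ ω c, StrictMono (U ω c)) (hR1 : Reg1 U)
    {Λ : Set ℝ} {ptilde : ℝ → Fin n → ℝ} (hFam : NOSFamily Λ ptilde)
    (y : ℝ) (k : Fin n) (pk : ℝ) (ω : Ω) {w : ℝ} (hw : w ∈ Λ) :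
    w ≤ NOSWelfare U Λ ptilde y k pk ω ↔
      ∀ c, U ω c (y - ptilde w c) ≤ U ω k (y - pk) := by
  set S : Set ℝ := {l | l ∈ Λ ∧ ∀ c, U ω c (y - ptilde l c) ≤ U ω k (y - pk)} with hS
  have hSup : NOSWelfare U Λ ptilde y k pk ω = sSup S := rfl
  have hbdd : BddAbove S := by
    obtain ⟨c, hc⟩ := hFam.unbddBelow
    obtain ⟨m, hm⟩ := (hR1 ω k c (y - pk)).2
    obtain ⟨l, hl, hlm⟩ := hc (y - m)
    refine ⟨l, fun l' hl' => ?_⟩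
    by_contra! hlt
    have hle : ptilde l' c ≤ ptilde l c := hFam.antitoneOn c hl hl'.1 hlt.le
    exact (hm (y - ptilde l' c) (by linarith)).not_ge (hl'.2 c)
  have hne : S.Nonempty := by
    choose m hm using fun c => (hR1 ω k c (y - pk)).1
    choose l hl hlm using fun c => hFam.unbddAbove c (y - m c)
    have : Nonempty (Fin n) := ⟨k⟩
    obtain ⟨c₀, hc₀⟩ := Finite.exists_min l
    refine ⟨l c₀, hl c₀, fun c => (hm c _ ?_).le⟩
    have hle : ptilde (l c) c ≤ ptilde (l c₀) c :=
      hFam.antitoneOn c (hl c₀) (hl c) (hc₀ c)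
    linarith [hlm c]
  have hclosed : IsClosed S := by
    have hcont : ContinuousOn (fun l c => U ω c (y - ptilde l c)) Λ :=
      continuousOn_pi.2 fun c =>
        (hCont ω c).comp_continuousOn (continuousOn_const.sub (hFam.cont c))
    exact hcont.preimage_isClosed_of_isClosed hFam.closed
      (isClosed_Iic (a := fun _ => U ω k (y - pk)))
  rw [hSup]
  refine ⟨fun h c => ?_, fun h => le_csSup hbdd ⟨hw, h⟩⟩
  have hmem : sSup S ∈ S := hclosed.csSup_mem hne hbdd
  have hle : ptilde (sSup S) c ≤ ptilde w c := hFam.antitoneOn c hw hmem.1 h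
  exact ((hMono ω c).monotone (by linarith)).trans (hmem.2 c)

/-- Optimality at `p` together with dominance over the prices `q` is optimality at the
componentwise minimum, provided the chosen alternative is cheaper at `p`. -/
theorem weakOpt_min_iff {Ω : Type*} {n : ℕ} {U : Ω → Fin n → ℝ → ℝ}
    (ω : Ω) (hMono : ∀ c, StrictMono (U ω c)) (p q : Fin n → ℝ) (y : ℝ) (i : Fin n) :
    ((∀ c, U ω c (y - q c) ≤ U ω i (y - p i)) ∧ WeakOpt U ω p y i) ↔
      p i ≤ q i ∧ WeakOpt U ω (fun c => min (p c) (q c)) y i := by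
  constructor
  · rintro ⟨hq, hp⟩
    have hi : p i ≤ q i := by linarith [(hMono i).le_iff_le.1 (hq i)]
    refine ⟨hi, fun c => ?_⟩
    simp only [min_eq_left hi]
    rcases min_choice (p c) (q c) with h | h <;> rw [h]
    exacts [hp c, hq c]
  · rintro ⟨hi, h⟩
    simp only [WeakOpt, min_eq_left hi] at h
    exact ⟨fun c => ((hMono c).monotone (sub_le_sub_left (min_le_right _ _) y)).trans (h c),
      fun c => ((hMono c).monotone (sub_le_sub_left (min_le_left _ _) y)).trans (h c)⟩

/-- Proposition 1, joint distribution of welfare before and after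
a price change. -/
theorem nos_welfare_joint_before_after {Ω : Type*} [MeasurableSpace Ω] {n : ℕ} (hn : 0 < n)
    (μ : Measure Ω) [IsProbabilityMeasure μ]
    (U : Ω → Fin n → ℝ → ℝ)
    (hCont : ∀ ω c, Continuous (U ω c))
    (hMono : ∀ ω c, StrictMono (U ω c))
    (hR1 : Reg1 U)
    (Λ : Set ℝ) (ptilde : ℝ → Fin n → ℝ) (hFam : NOSFamily Λ ptilde)
    (y : ℝ) (p p' : Fin n → ℝ) (i j : Fin n)
    (w z : ℝ) (hw : w ∈ Λ) (hz : z ∈ Λ) :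
    μ {ω | w ≤ NOSWelfare U Λ ptilde y i (p i) ω ∧
           z ≤ NOSWelfare U Λ ptilde y j (p' j) ω ∧
           WeakOpt U ω p y i ∧ WeakOpt U ω p' y j} =
      if p i ≤ ptilde w i ∧ p' j ≤ ptilde z j
      then TransProb μ U (fun c => min (p c) (ptilde w c))
        (fun c => min (p' c) (ptilde z c)) y i j
      else 0 := by
  have key : ∀ ω, (w ≤ NOSWelfare U Λ ptilde y i (p i) ω ∧
      z ≤ NOSWelfare U Λ ptilde y j (p' j) ω ∧ WeakOpt U ω p y i ∧ WeakOpt U ω p' y j) ↔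
      (p i ≤ ptilde w i ∧ p' j ≤ ptilde z j) ∧
        WeakOpt U ω (fun c => min (p c) (ptilde w c)) y i ∧
        WeakOpt U ω (fun c => min (p' c) (ptilde z c)) y j := by
    intro ω
    rw [le_nosWelfare_iff hCont hMono hR1 hFam y i (p i) ω hw,
      le_nosWelfare_iff hCont hMono hR1 hFam y j (p' j) ω hz]
    have hi := weakOpt_min_iff ω (hMono ω) p (ptilde w) y i
    have hj := weakOpt_min_iff ω (hMono ω) p' (ptilde z) y j
    tauto
  simp only [key]
  split_ifs with h
  · simp [h, TransProb]
  · simp [h]
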